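/- arXiv:1802.09351 — 5 statements merged into one kernel-verified Lean document; each statement's English description precedes it below -/
import Mathlib

section
/- Let X be a reflection space, o ∈ X a basepoint, and Y ⊆ X a subset with o ∈ Y. If g is an element of the restricted transvection group Trans(X)|_Y such that g(y) = y for all y ∈ Y, then g commutes with every element of Trans(X)|_Y; that is, the kernel of the action of Trans(X)|_Y on Y is central in Trans(X)|_Y. -/
/-- The elementary reflection `s_x : y ↦ x.y` of a reflection space, as a permutation;
it is an involutive bijection by (RS2). -/
def elemRefl {X : Type*} (μ : X → X → X) (rs2 : ∀ x y, μ x (μ x y) = y) (x : X) :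
    Equiv.Perm X :=
  ⟨μ x, μ x, rs2 x, rs2 x⟩

/-- Every element of a restricted transvection group is an automorphism of the
reflection space. -/
theorem map_mul_of_mem_closure {X : Type*} (μ : X → X → X)
    (rs2 : ∀ x y, μ x (μ x y) = y)
    (rs3 : ∀ x y z, μ x (μ y z) = μ (μ x y) (μ x z))
    (o : X) (Y : Set X) {g : Equiv.Perm X}
    (hg : g ∈ Subgroup.closure
      {p : Equiv.Perm X | ∃ y ∈ Y, p = elemRefl μ rs2 y * elemRefl μ rs2 o}) :
    ∀ x z, g (μ x z) = μ (g x) (g z) := by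
  induction hg using Subgroup.closure_induction with
  | mem p hp =>
    obtain ⟨y, -, rfl⟩ := hp
    intro x z
    change μ y (μ o (μ x z)) = μ (μ y (μ o x)) (μ y (μ o z))
    rw [rs3 o, rs3 y]
  | one => exact fun _ _ => rfl
  | mul a b _ _ ha hb =>
    intro x z
    simp only [Equiv.Perm.mul_apply, hb, ha]
  | inv a _ ha =>
    intro x z
    rw [Equiv.Perm.inv_eq_iff_eq, ha]
    simp

/-- An automorphism of a reflection space commutes with the reflection at any of its fixed
points. -/
theorem commute_elemRefl_of_fixed {X : Type*} (μ : X → X → X)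
    (rs2 : ∀ x y, μ x (μ x y) = y) {g : Equiv.Perm X}
    (hauto : ∀ x z, g (μ x z) = μ (g x) (g z)) {y : X} (hy : g y = y) :
    Commute g (elemRefl μ rs2 y) := by
  ext x
  change g (μ y x) = μ y (g x)
  rw [hauto, hy]

/-- For a reflection space `X` with basepoint `o` and a subset `Y ⊆ X` with
`o ∈ Y`, any element of the restricted transvection group `Trans(X)|_Y` fixing `Y` pointwise
is central in `Trans(X)|_Y`. -/
theorem kernel_of_restricted_transvection_action_central {X : Type*} (μ : X → X → X)
    (rs1 : ∀ x, μ x x = x)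
    (rs2 : ∀ x y, μ x (μ x y) = y)
    (rs3 : ∀ x y z, μ x (μ y z) = μ (μ x y) (μ x z))
    (o : X) (Y : Set X) (hoY : o ∈ Y)
    (g : Equiv.Perm X)
    (hg : g ∈ Subgroup.closure
      {p : Equiv.Perm X | ∃ y ∈ Y, p = elemRefl μ rs2 y * elemRefl μ rs2 o})
    (hfix : ∀ y ∈ Y, g y = y) :
    ∀ h ∈ Subgroup.closure
      {p : Equiv.Perm X | ∃ y ∈ Y, p = elemRefl μ rs2 y * elemRefl μ rs2 o},
      g * h = h * g := by
  intro h hh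
  have hauto := map_mul_of_mem_closure μ rs2 rs3 o Y hg
  have hcomm : ∀ y ∈ Y, Commute g (elemRefl μ rs2 y) := fun y hy =>
    commute_elemRefl_of_fixed μ rs2 hauto (hfix y hy)
  induction hh using Subgroup.closure_induction with
  | mem p hp =>
    obtain ⟨y, hy, rfl⟩ := hp
    exact (hcomm y hy).mul_right (hcomm o hoY)
  | one => exact Commute.one_right g
  | mul a b _ _ ha hb => exact Commute.mul_right ha hb
  | inv a _ ha => exact Commute.inv_right ha
end

section
/- Let G be a group and θ : G → G an automorphism with θ ∘ θ = id. Let K := {g ∈ G : θ(g) = g}, τ(g) := g·θ(g)⁻¹, and equip the left coset space G/K with the reflection map μ(gK, hK) := τ(g)·θ(h)·K. If K ∩ τ(G) = {e}, then (G/K, μ) also satisfies axiom (RS4): for all x, y ∈ G/K, x.y = y implies x = y; that is, G/K is a symmetric space. -/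
/-- The subgroup of fixed points of an automorphism `θ : G → G`. -/
def fixedSubgroup {G : Type*} [Group G] (θ : G →* G) : Subgroup G where
  carrier := {g | θ g = g}
  one_mem' := by simp
  mul_mem' := by
    intro a b ha hb
    simp only [Set.mem_setOf_eq, map_mul] at *
    rw [ha, hb]
  inv_mem' := by
    intro a ha
    simp only [Set.mem_setOf_eq, map_inv] at *
    rw [ha]

/-- In the `G/K`-construction with `θ` an involutive automorphism,
`K = G^θ`, `τ(g) = g θ(g)⁻¹`, and the reflection map `μ(gK, hK) = τ(g) θ(h) K`,
if `K ∩ τ(G) = {e}` then `G/K` satisfies (RS4): `x.y = y` implies `x = y`;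
that is, `G/K` is a symmetric space. -/
theorem GmodK_symmetric_space {G : Type*} [Group G] (θ : G →* G) (hinv : ∀ g, θ (θ g) = g)
    (μ : G ⧸ fixedSubgroup θ → G ⧸ fixedSubgroup θ → G ⧸ fixedSubgroup θ)
    (hμ : ∀ g h : G, μ (↑g) (↑h) = ((g * (θ g)⁻¹ * θ h : G) : G ⧸ fixedSubgroup θ))
    (htriv : ∀ g : G, g * (θ g)⁻¹ ∈ fixedSubgroup θ → g * (θ g)⁻¹ = 1) :
    ∀ x y : G ⧸ fixedSubgroup θ, μ x y = y → x = y := by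
  intro x y
  induction x using QuotientGroup.induction_on with | _ g
  induction y using QuotientGroup.induction_on with | _ h
  intro hxy
  rw [hμ] at hxy
  have hmem : (h⁻¹ * g) * (θ (h⁻¹ * g))⁻¹ ∈ fixedSubgroup θ := by
    simpa [mul_assoc] using QuotientGroup.eq.mp hxy.symm
  exact (QuotientGroup.eq.mpr (mul_inv_eq_one.mp (htriv _ hmem)).symm).symm
end

section
/- Let G be a group, θ : G → G an automorphism with θ ∘ θ = id, K := {g ∈ G : θ(g) = g}, and τ(g) := g·θ(g)⁻¹. Let (X, o) be a pointed reflection space and f : G → X a map with f(e) = o, with f(g) = f(h) if and only if g⁻¹h ∈ K, and with f(τ(g)·θ(h)) = f(g).f(h) for all g, h ∈ G (so f realizes G/K as an embedded subspace of X). Let {g_i : i ∈ I} be a generating set of G, and for each i ∈ I let T_i be an element of the restricted transvection group Trans(X)|_{f(G)} satisfying T_i(f(h)) = f(g_i·h) for all h ∈ G. Then Trans(X)|_{f(G)} is generated by the set {T_i : i ∈ I} ∪ {s_o ∘ T_i⁻¹ ∘ s_o : i ∈ I}. -/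
/-- Conjugation by an involution `s` preserves the subgroup generated by `S` as soon as it maps
`S` into that subgroup. -/
theorem Subgroup.involution_conj_mem_closure {P : Type*} [Group P] {s : P} (hs : s * s = 1)
    {S : Set P} (hS : ∀ x ∈ S, s * x * s ∈ Subgroup.closure S) {x : P}
    (hx : x ∈ Subgroup.closure S) : s * x * s ∈ Subgroup.closure S := by
  have hs' : s⁻¹ = s := inv_eq_of_mul_eq_one_left hs
  induction hx using Subgroup.closure_induction with
  | mem x hx => exact hS x hx
  | one => simp [hs]
  | mul x y _ _ hx hy =>
    have h : s * (x * y) * s = s * x * s * (s * y * s) := by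
      calc s * (x * y) * s = s * x * 1 * y * s := by group
        _ = s * x * (s * s) * y * s := by rw [hs]
        _ = s * x * s * (s * y * s) := by group
    rw [h]
    exact mul_mem hx hy
  | inv x _ hx => simpa [hs', mul_assoc] using inv_mem hx

/-- The automorphism group of a set with a binary operation. -/
def binaryOpAut {X : Type*} (μ : X → X → X) : Subgroup (Equiv.Perm X) where
  carrier := {p | ∀ x y, p (μ x y) = μ (p x) (p y)}
  one_mem' _ _ := rfl
  mul_mem' {p q} hp hq x y := by
    rw [Equiv.Perm.mul_apply, hq, hp]; rfl
  inv_mem' {p} hp x y := by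
    apply p.injective
    rw [hp]
    simp

theorem elemRefl_mul_self {X : Type*} (μ : X → X → X) (rs2 : ∀ x y, μ x (μ x y) = y) (x : X) :
    elemRefl μ rs2 x * elemRefl μ rs2 x = 1 :=
  Equiv.ext (rs2 x)

theorem mul_elemRefl_mul_inv {X : Type*} {μ : X → X → X} (rs2 : ∀ x y, μ x (μ x y) = y)
    {p : Equiv.Perm X} (hp : p ∈ binaryOpAut μ) (x : X) :
    p * elemRefl μ rs2 x * p⁻¹ = elemRefl μ rs2 (p x) := by
  ext y
  have h := hp x (p⁻¹ y)
  rw [show p (p⁻¹ y) = y from p.apply_symm_apply y] at h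
  exact h

/-- Let `G` be a group with an involutive automorphism `θ`, `K = G^θ`,
`τ(g) = g θ(g)⁻¹`, and let `f : G → X` realize `G/K` as an embedded subspace of a pointed
reflection space `(X, o)`.  Given a generating set `{g_i}` of `G` and elements `T_i` of the
restricted transvection group `Trans(X)|_{f(G)}` acting on `f(G)` by left multiplication
with `g_i`, the group `Trans(X)|_{f(G)}` is generated by
`{T_i : i ∈ I} ∪ {s_o ∘ T_i⁻¹ ∘ s_o : i ∈ I}`. -/
theorem restricted_transvections_generated {G : Type*} [Group G] (θ : G →* G)
    (hinv : ∀ g, θ (θ g) = g)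
    {X : Type*} (μ : X → X → X)
    (rs1 : ∀ x, μ x x = x)
    (rs2 : ∀ x y, μ x (μ x y) = y)
    (rs3 : ∀ x y z, μ x (μ y z) = μ (μ x y) (μ x z))
    (o : X) (f : G → X)
    (hf1 : f 1 = o)
    (hfK : ∀ g h : G, f g = f h ↔ θ (g⁻¹ * h) = g⁻¹ * h)
    (hfμ : ∀ g h : G, f (g * (θ g)⁻¹ * θ h) = μ (f g) (f h))
    {I : Type*} (gi : I → G) (hgen : Subgroup.closure (Set.range gi) = ⊤)
    (T : I → Equiv.Perm X)
    (hT : ∀ i, T i ∈ Subgroup.closure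
      {p : Equiv.Perm X | ∃ g : G, p = elemRefl μ rs2 (f g) * elemRefl μ rs2 o})
    (hTact : ∀ i, ∀ h : G, (T i) (f h) = f (gi i * h)) :
    Subgroup.closure
      {p : Equiv.Perm X | ∃ g : G, p = elemRefl μ rs2 (f g) * elemRefl μ rs2 o}
      = Subgroup.closure
        (Set.range T ∪ Set.range fun i => elemRefl μ rs2 o * (T i)⁻¹ * elemRefl μ rs2 o) := by
  set s : X → Equiv.Perm X := elemRefl μ rs2
  set A : Set (Equiv.Perm X) := {p | ∃ g : G, p = s (f g) * s o}
  set B : Set (Equiv.Perm X) := Set.range T ∪ Set.range fun i => s o * (T i)⁻¹ * s o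
  have hss : s o * s o = 1 := elemRefl_mul_self μ rs2 o
  have hs' : ∀ x, (s x)⁻¹ = s x := fun x =>
    inv_eq_of_mul_eq_one_left (elemRefl_mul_self μ rs2 x)
  have hsA : ∀ p ∈ A, s o * p * s o ∈ Subgroup.closure A := by
    rintro _ ⟨g, rfl⟩
    have h := inv_mem (Subgroup.subset_closure (show s (f g) * s o ∈ A from ⟨g, rfl⟩))
    rw [mul_inv_rev, hs', hs'] at h
    rwa [← mul_assoc, mul_assoc (s o * s (f g)), hss, mul_one]
  have hsB : ∀ p ∈ B, s o * p * s o ∈ Subgroup.closure B := by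
    rintro _ (⟨i, rfl⟩ | ⟨i, rfl⟩)
    · have h := inv_mem (Subgroup.subset_closure
        (show s o * (T i)⁻¹ * s o ∈ B from Or.inr ⟨i, rfl⟩))
      simpa [hs', mul_assoc] using h
    · have h : s o * (s o * (T i)⁻¹ * s o) * s o = (T i)⁻¹ := by
        calc s o * (s o * (T i)⁻¹ * s o) * s o = (s o * s o) * (T i)⁻¹ * (s o * s o) := by group
          _ = (T i)⁻¹ := by rw [hss, one_mul, mul_one]
      exact h ▸ inv_mem (Subgroup.subset_closure (Or.inl ⟨i, rfl⟩))
  have hBA : Subgroup.closure B ≤ Subgroup.closure A := by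
    rw [Subgroup.closure_le]
    rintro _ (⟨i, rfl⟩ | ⟨i, rfl⟩)
    · exact hT i
    · exact Subgroup.involution_conj_mem_closure hss hsA (inv_mem (hT i))
  have hA_aut : Subgroup.closure A ≤ binaryOpAut μ := by
    have hs_aut : ∀ x, s x ∈ binaryOpAut μ := fun x => rs3 x
    rw [Subgroup.closure_le]
    rintro _ ⟨g, rfl⟩
    exact mul_mem (hs_aut _) (hs_aut _)
  have key : ∀ g : G, ∃ p ∈ Subgroup.closure B, ∀ h, p (f h) = f (g * h) := by
    intro g
    have hg : g ∈ Subgroup.closure (Set.range gi) := hgen ▸ Subgroup.mem_top g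
    induction hg using Subgroup.closure_induction with
    | mem g hg =>
      obtain ⟨i, rfl⟩ := hg
      exact ⟨T i, Subgroup.subset_closure (Or.inl ⟨i, rfl⟩), hTact i⟩
    | one => exact ⟨1, one_mem _, fun h => by simp⟩
    | mul a b _ _ ha hb =>
      obtain ⟨p, hp, hpa⟩ := ha
      obtain ⟨q, hq, hqb⟩ := hb
      exact ⟨p * q, mul_mem hp hq, fun h => by
        rw [Equiv.Perm.mul_apply, hqb, hpa, mul_assoc]⟩
    | inv a _ ha =>
      obtain ⟨p, hp, hpa⟩ := ha
      exact ⟨p⁻¹, inv_mem hp, fun h => by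
        rw [Equiv.Perm.inv_eq_iff_eq, hpa, mul_inv_cancel_left]⟩
  refine le_antisymm ?_ hBA
  rw [Subgroup.closure_le]
  rintro _ ⟨g, rfl⟩
  obtain ⟨p, hp, hpg⟩ := key g
  have hpo : p o = f g := by rw [← hf1, hpg, mul_one]
  have hconj : s (f g) = p * s o * p⁻¹ := by
    rw [← hpo]
    exact (mul_elemRefl_mul_inv rs2 (hA_aut (hBA hp)) o).symm
  rw [hconj, mul_assoc, mul_assoc, ← mul_assoc (s o)]
  exact mul_mem hp (Subgroup.involution_conj_mem_closure hss hsB (inv_mem hp))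
end

section
/- For t > 0, let a(t), b(t), c denote the unique symmetric positive definite square roots of the matrices A(t) := (1/√2)·[[3t, −1], [−1, 1/t]], B(t) := [[1/t, 1], [1, 2t]], and C := [[1/√2, 0], [0, √2]] respectively. Then for every t > 0 the matrices a(t/2)⁻¹·C·a(t) and b(t/2)⁻¹·C⁻¹·b(t) are orthogonal, i.e., M·Mᵀ = 1 for M = a(t/2)⁻¹·C·a(t) and for M = b(t/2)⁻¹·C⁻¹·b(t); since these matrices have determinant 1, they lie in SO(2). -/
open Matrix

noncomputable def Amat (t : ℝ) : Matrix (Fin 2) (Fin 2) ℝ :=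
  (Real.sqrt 2)⁻¹ • !![3 * t, -1; -1, 1 / t]

noncomputable def Bmat (t : ℝ) : Matrix (Fin 2) (Fin 2) ℝ :=
  !![1 / t, 1; 1, 2 * t]

noncomputable def Cmat : Matrix (Fin 2) (Fin 2) ℝ :=
  !![(Real.sqrt 2)⁻¹, 0; 0, Real.sqrt 2]

/-- If `D * Q² * Dᵀ = P²` with `P`, `Q` positive definite and `0 < det D`, then `P⁻¹ * D * Q` is
a special orthogonal matrix. -/
theorem Matrix.PosDef.inv_mul_mul_special_orthogonal {n : Type*} [Fintype n] [DecidableEq n]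
    {P Q D : Matrix n n ℝ} (hP : P.PosDef) (hQ : Q.PosDef) (hD : 0 < D.det)
    (h : D * (Q * Q) * Dᵀ = P * P) :
    (P⁻¹ * D * Q) * (P⁻¹ * D * Q)ᵀ = 1 ∧ (P⁻¹ * D * Q).det = 1 := by
  have hPt : Pᵀ = P := by simpa using hP.isHermitian.eq
  have hQt : Qᵀ = Q := by simpa using hQ.isHermitian.eq
  have hPu : IsUnit P.det := hP.det_pos.ne'.isUnit
  have horth : (P⁻¹ * D * Q) * (P⁻¹ * D * Q)ᵀ = 1 := by
    calc (P⁻¹ * D * Q) * (P⁻¹ * D * Q)ᵀ = P⁻¹ * (D * (Q * Q) * Dᵀ) * P⁻¹ := by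
          simp only [transpose_mul, transpose_nonsing_inv, hPt, hQt, Matrix.mul_assoc]
      _ = 1 := by
          rw [h, ← Matrix.mul_assoc, nonsing_inv_mul _ hPu, Matrix.one_mul, mul_nonsing_inv _ hPu]
  refine ⟨horth, ?_⟩
  have hpos : 0 < (P⁻¹ * D * Q).det := by
    rw [det_mul, det_mul]
    exact mul_pos (mul_pos hP.inv.det_pos hD) hQ.det_pos
  have hsq := congrArg det horth
  rw [det_mul, det_transpose, det_one] at hsq
  nlinarith

theorem Cmat_det : Cmat.det = 1 := by
  simp [Cmat, det_fin_two]

theorem Cmat_inv : Cmat⁻¹ = !![Real.sqrt 2, 0; 0, (Real.sqrt 2)⁻¹] := by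
  apply inv_eq_right_inv
  ext i j
  fin_cases i <;> fin_cases j <;> simp [Cmat]

theorem Cmat_mul_Amat_mul_transpose {t : ℝ} (ht : t ≠ 0) :
    Cmat * Amat t * Cmatᵀ = Amat (t / 2) := by
  have h2 : Real.sqrt 2 ^ 2 = 2 := Real.sq_sqrt (by norm_num)
  ext i j
  fin_cases i <;> fin_cases j <;>
    simp [Cmat, Amat, Matrix.mul_apply, Fin.sum_univ_two] <;> field_simp <;> simp [h2]

theorem Cmat_inv_mul_Bmat_mul_transpose {t : ℝ} (ht : t ≠ 0) :
    Cmat⁻¹ * Bmat t * Cmat⁻¹ᵀ = Bmat (t / 2) := by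
  have h2 : Real.sqrt 2 ^ 2 = 2 := Real.sq_sqrt (by norm_num)
  rw [Cmat_inv]
  ext i j
  fin_cases i <;> fin_cases j <;>
    simp [Bmat, Matrix.mul_apply, Fin.sum_univ_two] <;> field_simp <;> simp [h2]

/-- If `a(t)`, `b(t)` are the (unique) symmetric positive definite square
roots of `A(t)`, `B(t)` for `t > 0`, then for every `t > 0` the matrices
`a(t/2)⁻¹ C a(t)` and `b(t/2)⁻¹ C⁻¹ b(t)` satisfy `M Mᵀ = 1` and `det M = 1`,
i.e. they lie in `SO(2)`. -/
theorem sqrt_conjugates_in_SO2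
    (a b : ℝ → Matrix (Fin 2) (Fin 2) ℝ)
    (ha : ∀ t : ℝ, 0 < t → (a t).PosDef ∧ a t * a t = Amat t)
    (hb : ∀ t : ℝ, 0 < t → (b t).PosDef ∧ b t * b t = Bmat t) :
    ∀ t : ℝ, 0 < t →
      ((a (t / 2))⁻¹ * Cmat * a t) * ((a (t / 2))⁻¹ * Cmat * a t)ᵀ = 1 ∧
      ((a (t / 2))⁻¹ * Cmat * a t).det = 1 ∧
      ((b (t / 2))⁻¹ * Cmat⁻¹ * b t) * ((b (t / 2))⁻¹ * Cmat⁻¹ * b t)ᵀ = 1 ∧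
      ((b (t / 2))⁻¹ * Cmat⁻¹ * b t).det = 1 := by
  intro t ht
  obtain ⟨hat, hat2⟩ := ha t ht
  obtain ⟨hah, hah2⟩ := ha (t / 2) (half_pos ht)
  obtain ⟨hbt, hbt2⟩ := hb t ht
  obtain ⟨hbh, hbh2⟩ := hb (t / 2) (half_pos ht)
  have hA := hah.inv_mul_mul_special_orthogonal (D := Cmat) hat (by simp [Cmat_det])
    (by rw [hat2, hah2, Cmat_mul_Amat_mul_transpose ht.ne'])
  have hB := hbh.inv_mul_mul_special_orthogonal (D := Cmat⁻¹) hbt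
    (by simp [det_nonsing_inv, Cmat_det])
    (by rw [hbt2, hbh2, Cmat_inv_mul_Bmat_mul_transpose ht.ne'])
  exact ⟨hA.1, hA.2, hB.1, hB.2⟩
end

section
/- In the embedded-hyperbolic-plane setting, for every t > 0 and every h ∈ SL(2,ℝ) one has x_+(t)(f(h)) = f([[1, t], [0, 1]]·h) and x_−(t)(f(h)) = f([[1, 0], [t, 1]]·h); that is, x_+(t) and x_−(t) act on the image of f by left multiplication with the upper and lower shear matrices respectively. -/
open Matrix

/-- `SL(2,ℝ)`. -/
abbrev SL2 := Matrix.SpecialLinearGroup (Fin 2) ℝ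

/-- The transpose, as a map `SL(2,ℝ) → SL(2,ℝ)`. -/
def transpSL (g : SL2) : SL2 :=
  ⟨(g : Matrix (Fin 2) (Fin 2) ℝ)ᵀ, by rw [Matrix.det_transpose]; exact g.2⟩

/-- The Cartan--Chevalley involution `θ(g) = (gᵀ)⁻¹` of `SL(2,ℝ)`. -/
def thetaSL (g : SL2) : SL2 := (transpSL g)⁻¹

/-- The twist map `τ(g) = g gᵀ` of `SL(2,ℝ)`. -/
def tauSL (g : SL2) : SL2 := g * transpSL g

/-- The upper shear matrix `[[1,t],[0,1]]` as an element of `SL(2,ℝ)`. -/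
def shearU (t : ℝ) : SL2 := ⟨!![1, t; 0, 1], by simp [Matrix.det_fin_two_of]⟩

/-- The lower shear matrix `[[1,0],[t,1]]` as an element of `SL(2,ℝ)`. -/
def shearL (t : ℝ) : SL2 := ⟨!![1, 0; t, 1], by simp [Matrix.det_fin_two_of]⟩

/-- The elementary transvection `tr_{f(g)} = s_{f(g)} ∘ s_o`. -/
def trv {X : Type*} (μ : X → X → X) (rs2 : ∀ x y, μ x (μ x y) = y) (o : X)
    (f : SL2 → X) (g : SL2) : Equiv.Perm X :=
  elemRefl μ rs2 (f g) * elemRefl μ rs2 o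

/-- `x_+(t) = tr_{f(a(t))} ∘ tr_{f(b(t))} ∘ tr_{f(c)}`. -/
def xplus {X : Type*} (μ : X → X → X) (rs2 : ∀ x y, μ x (μ x y) = y) (o : X)
    (f : SL2 → X) (a b : ℝ → SL2) (c : SL2) (t : ℝ) : Equiv.Perm X :=
  trv μ rs2 o f (a t) * trv μ rs2 o f (b t) * trv μ rs2 o f c

/-- `x_−(t) = tr_{f(c)} ∘ tr_{f(b(t))} ∘ tr_{f(a(t))}`. -/
def xminus {X : Type*} (μ : X → X → X) (rs2 : ∀ x y, μ x (μ x y) = y) (o : X)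
    (f : SL2 → X) (a b : ℝ → SL2) (c : SL2) (t : ℝ) : Equiv.Perm X :=
  trv μ rs2 o f c * trv μ rs2 o f (b t) * trv μ rs2 o f (a t)

theorem thetaSL_thetaSL (h : SL2) : thetaSL (thetaSL h) = h := by
  have htr (g k : SL2) : transpSL (g * k) = transpSL k * transpSL g :=
    Subtype.ext (Matrix.transpose_mul _ _)
  have hone : transpSL 1 = 1 := Subtype.ext Matrix.transpose_one
  have htt : transpSL (transpSL h) = h := Subtype.ext (Matrix.transpose_transpose _)
  have hmul : transpSL (transpSL h)⁻¹ * h = 1 := by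
    have := congrArg transpSL (mul_inv_cancel (transpSL h))
    rwa [htr, htt, hone] at this
  exact inv_eq_of_mul_eq_one_right hmul

theorem tauSL_one : tauSL 1 = 1 := by
  rw [tauSL, one_mul]
  exact Subtype.ext Matrix.transpose_one

/-- The twist map squares symmetric matrices. -/
theorem coe_tauSL_of_posDef {g : SL2} (hg : (g : Matrix (Fin 2) (Fin 2) ℝ).PosDef) :
    (tauSL g : Matrix (Fin 2) (Fin 2) ℝ) = (g : Matrix (Fin 2) (Fin 2) ℝ) * g := by
  have hT : (g : Matrix (Fin 2) (Fin 2) ℝ)ᵀ = g := by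
    simpa [Matrix.conjTranspose_eq_transpose_of_trivial] using hg.isHermitian.eq
  change (g : Matrix (Fin 2) (Fin 2) ℝ) * (g : Matrix (Fin 2) (Fin 2) ℝ)ᵀ = _
  rw [hT]

/-- The transvection at `f g` acts on the image of `f` as left multiplication by `τ(g)`. -/
theorem trv_apply {X : Type*} (μ : X → X → X) (rs2 : ∀ x y, μ x (μ x y) = y)
    (o : X) (f : SL2 → X) (hf1 : f 1 = o)
    (hfμ : ∀ g h : SL2, f (tauSL g * thetaSL h) = μ (f g) (f h)) (g h : SL2) :
    trv μ rs2 o f g (f h) = f (tauSL g * h) := by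
  change μ (f g) (μ o (f h)) = _
  rw [← hf1, ← hfμ, tauSL_one, one_mul, ← hfμ, thetaSL_thetaSL]

theorem Amat_mul_Bmat_mul_Cmat {t : ℝ} (ht : t ≠ 0) :
    Amat t * Bmat t * Cmat = !![1, t; 0, 1] := by
  have h2 : Real.sqrt 2 * Real.sqrt 2 = 2 := Real.mul_self_sqrt (by norm_num)
  have h0 : Real.sqrt 2 ≠ 0 := by positivity
  ext i j
  fin_cases i <;> fin_cases j <;>
    simp [Amat, Bmat, Cmat, Matrix.mul_apply, Fin.sum_univ_two] <;> field_simp <;>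
    linarith

theorem Cmat_mul_Bmat_mul_Amat {t : ℝ} (ht : t ≠ 0) :
    Cmat * Bmat t * Amat t = !![1, 0; t, 1] := by
  have hA : (Amat t)ᵀ = Amat t := by
    ext i j; fin_cases i <;> fin_cases j <;> simp [Amat]
  have hB : (Bmat t)ᵀ = Bmat t := by
    ext i j; fin_cases i <;> fin_cases j <;> simp [Bmat]
  have hC : Cmatᵀ = Cmat := by
    ext i j; fin_cases i <;> fin_cases j <;> simp [Cmat]
  have h := congrArg Matrix.transpose (Amat_mul_Bmat_mul_Cmat ht)
  rw [Matrix.transpose_mul, Matrix.transpose_mul, hA, hB, hC, ← Matrix.mul_assoc] at h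
  rw [h]
  ext i j; fin_cases i <;> fin_cases j <;> simp

/-- In the embedded-hyperbolic-plane setting, `x_+(t)` and `x_−(t)` act on the
image of `f` by left multiplication with the upper and lower shear matrices respectively. -/
theorem xplus_xminus_act_by_shears {X : Type*} (μ : X → X → X)
    (rs1 : ∀ x, μ x x = x)
    (rs2 : ∀ x y, μ x (μ x y) = y)
    (rs3 : ∀ x y z, μ x (μ y z) = μ (μ x y) (μ x z))
    (o : X) (f : SL2 → X)
    (hf1 : f 1 = o)
    (hfK : ∀ g h : SL2, f g = f h ↔ (g⁻¹ * h) * transpSL (g⁻¹ * h) = 1)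
    (hfμ : ∀ g h : SL2, f (tauSL g * thetaSL h) = μ (f g) (f h))
    (a b : ℝ → SL2) (c : SL2)
    (ha : ∀ t : ℝ, 0 < t → ((a t : Matrix (Fin 2) (Fin 2) ℝ)).PosDef ∧
      (a t : Matrix (Fin 2) (Fin 2) ℝ) * (a t : Matrix (Fin 2) (Fin 2) ℝ) = Amat t)
    (hb : ∀ t : ℝ, 0 < t → ((b t : Matrix (Fin 2) (Fin 2) ℝ)).PosDef ∧
      (b t : Matrix (Fin 2) (Fin 2) ℝ) * (b t : Matrix (Fin 2) (Fin 2) ℝ) = Bmat t)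
    (hc : ((c : Matrix (Fin 2) (Fin 2) ℝ)).PosDef ∧
      (c : Matrix (Fin 2) (Fin 2) ℝ) * (c : Matrix (Fin 2) (Fin 2) ℝ) = Cmat) :
    ∀ t : ℝ, 0 < t → ∀ h : SL2,
      (xplus μ rs2 o f a b c t) (f h) = f (shearU t * h) ∧
      (xminus μ rs2 o f a b c t) (f h) = f (shearL t * h) := by
  intro t ht h
  have hA := (coe_tauSL_of_posDef (ha t ht).1).trans (ha t ht).2
  have hB := (coe_tauSL_of_posDef (hb t ht).1).trans (hb t ht).2
  have hC := (coe_tauSL_of_posDef hc.1).trans hc.2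
  have hU : tauSL (a t) * tauSL (b t) * tauSL c = shearU t := Subtype.ext <| by
    rw [Matrix.SpecialLinearGroup.coe_mul, Matrix.SpecialLinearGroup.coe_mul, hA, hB, hC]
    exact Amat_mul_Bmat_mul_Cmat ht.ne'
  have hL : tauSL c * tauSL (b t) * tauSL (a t) = shearL t := Subtype.ext <| by
    rw [Matrix.SpecialLinearGroup.coe_mul, Matrix.SpecialLinearGroup.coe_mul, hA, hB, hC]
    exact Cmat_mul_Bmat_mul_Amat ht.ne'
  constructor
  · rw [xplus, Equiv.Perm.mul_apply, Equiv.Perm.mul_apply]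
    simp only [trv_apply μ rs2 o f hf1 hfμ]
    rw [← hU, mul_assoc, mul_assoc]
  · rw [xminus, Equiv.Perm.mul_apply, Equiv.Perm.mul_apply]
    simp only [trv_apply μ rs2 o f hf1 hfμ]
    rw [← hL, mul_assoc, mul_assoc]
end
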